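/- Let C > 0 and let ξ : ℝ → [0,1] be a measurable function with ξ(λ) = 0 for λ ∉ [0,C]. Define Δ(z) = exp(∫₀^∞ ξ(λ)/(λ − z) dλ) for z ∈ ℂ∖[0,∞). Then for every z with Im z > 0 one has 0 ≤ Im ∫₀^∞ ξ(λ)/(λ − z) dλ ≤ π, and consequently Im Δ(z) ≥ 0; that is, Δ is a Herglotz function on the upper half-plane. -/

import Mathlib

open MeasureTheory

theorem poisson_kernel_eq_inv_one_add_sq (x l : ℝ) {y : ℝ} (hy : 0 < y) :
    y / ((l - x) ^ 2 + y ^ 2) = y⁻¹ * (1 + ((l - x) / y) ^ 2)⁻¹ := by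
  have : 0 < (l - x) ^ 2 + y ^ 2 := by positivity
  have : 0 < 1 + ((l - x) / y) ^ 2 := by positivity
  field_simp
  ring

theorem integrable_poisson_kernel (x : ℝ) {y : ℝ} (hy : 0 < y) :
    Integrable fun l : ℝ => y / ((l - x) ^ 2 + y ^ 2) := by
  simp_rw [poisson_kernel_eq_inv_one_add_sq x _ hy]
  exact ((integrable_inv_one_add_sq.comp_div hy.ne').comp_sub_right x).const_mul _

theorem integral_poisson_kernel (x : ℝ) {y : ℝ} (hy : 0 < y) :
    ∫ l : ℝ, y / ((l - x) ^ 2 + y ^ 2) = Real.pi := by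
  simp_rw [poisson_kernel_eq_inv_one_add_sq x _ hy]
  rw [integral_const_mul,
    integral_sub_right_eq_self (fun l : ℝ => (1 + (l / y) ^ 2)⁻¹) x,
    Measure.integral_comp_div (fun l : ℝ => (1 + l ^ 2)⁻¹) y, integral_univ_inv_one_add_sq,
    abs_of_pos hy, smul_eq_mul, inv_mul_cancel_left₀ hy.ne']

theorem im_ofReal_div_ofReal_sub (a l : ℝ) (z : ℂ) :
    ((a : ℂ) / ((l : ℂ) - z)).im = a * (z.im / ((l - z.re) ^ 2 + z.im ^ 2)) := by
  simp only [Complex.div_im, Complex.normSq_apply, Complex.ofReal_re, Complex.ofReal_im,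
    Complex.sub_re, Complex.sub_im]
  ring

theorem integrable_ofReal_div_ofReal_sub {C : ℝ} {ξ : ℝ → ℝ} (hmeas : Measurable ξ)
    (h01 : ∀ l : ℝ, ξ l ∈ Set.Icc (0 : ℝ) 1)
    (hsupp : ∀ l : ℝ, l ∉ Set.Icc (0 : ℝ) C → ξ l = 0) {z : ℂ} (hz : 0 < z.im) :
    Integrable fun l : ℝ => (ξ l : ℂ) / ((l : ℂ) - z) := by
  have hsub : Function.support (fun l : ℝ => (ξ l : ℂ) / ((l : ℂ) - z)) ⊆ Set.Icc 0 C := by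
    intro l hl
    by_contra h
    exact hl (by simp [hsupp l h])
  rw [← integrableOn_iff_integrable_of_support_subset hsub]
  have hm : Measurable fun l : ℝ => (ξ l : ℂ) / ((l : ℂ) - z) := by fun_prop
  refine Measure.integrableOn_of_bounded (M := 1 / z.im) (by simp) hm.aestronglyMeasurable
    (Filter.Eventually.of_forall fun l => ?_)
  have him : z.im ≤ ‖(l : ℂ) - z‖ := by
    simpa [abs_of_pos hz] using Complex.abs_im_le_norm ((l : ℂ) - z)
  rw [norm_div, Complex.norm_real, Real.norm_of_nonneg (h01 l).1]
  exact div_le_div₀ zero_le_one (h01 l).2 hz him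

theorem statement15 (C : ℝ) (hC : 0 < C) (ξ : ℝ → ℝ) (hmeas : Measurable ξ)
    (h01 : ∀ l : ℝ, ξ l ∈ Set.Icc (0 : ℝ) 1)
    (hsupp : ∀ l : ℝ, l ∉ Set.Icc (0 : ℝ) C → ξ l = 0)
    (z : ℂ) (hz : 0 < z.im) :
    0 ≤ (∫ l in Set.Ioi (0 : ℝ), (ξ l : ℂ) / ((l : ℂ) - z)).im ∧
    (∫ l in Set.Ioi (0 : ℝ), (ξ l : ℂ) / ((l : ℂ) - z)).im ≤ Real.pi ∧
    0 ≤ (Complex.exp (∫ l in Set.Ioi (0 : ℝ), (ξ l : ℂ) / ((l : ℂ) - z))).im := by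
  have hint := integrable_ofReal_div_ofReal_sub hmeas h01 hsupp hz
  have him : (∫ l in Set.Ioi (0 : ℝ), (ξ l : ℂ) / ((l : ℂ) - z)).im =
      ∫ l in Set.Ioi (0 : ℝ), ξ l * (z.im / ((l - z.re) ^ 2 + z.im ^ 2)) := by
    simp_rw [← im_ofReal_div_ofReal_sub]
    exact (integral_im hint.integrableOn).symm
  have hker : ∀ l : ℝ, 0 ≤ z.im / ((l - z.re) ^ 2 + z.im ^ 2) := fun l => by positivity
  have hkint := integrable_poisson_kernel z.re hz
  have hlower : 0 ≤ (∫ l in Set.Ioi (0 : ℝ), (ξ l : ℂ) / ((l : ℂ) - z)).im := by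
    rw [him]
    exact integral_nonneg fun l => mul_nonneg (h01 l).1 (hker l)
  have hupper : (∫ l in Set.Ioi (0 : ℝ), (ξ l : ℂ) / ((l : ℂ) - z)).im ≤ Real.pi := by
    rw [him, ← integral_poisson_kernel z.re hz]
    calc ∫ l in Set.Ioi (0 : ℝ), ξ l * (z.im / ((l - z.re) ^ 2 + z.im ^ 2))
        ≤ ∫ l in Set.Ioi (0 : ℝ), z.im / ((l - z.re) ^ 2 + z.im ^ 2) :=
          integral_mono_of_nonneg
            (Filter.Eventually.of_forall fun l => mul_nonneg (h01 l).1 (hker l))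
            hkint.integrableOn
            (Filter.Eventually.of_forall fun l => mul_le_of_le_one_left (hker l) (h01 l).2)
      _ ≤ ∫ l : ℝ, z.im / ((l - z.re) ^ 2 + z.im ^ 2) :=
          setIntegral_le_integral hkint (Filter.Eventually.of_forall hker)
  refine ⟨hlower, hupper, ?_⟩
  rw [Complex.exp_im]
  exact mul_nonneg (Real.exp_pos _).le (Real.sin_nonneg_of_nonneg_of_le_pi hlower hupper)
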